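/- Let {X_t}_{t≥0} be the parallel Kac's walk on the complex unit sphere of ℂ^n. For sufficiently large n, c > 0 and T = 10(c+1) log n, sup over starting points X₀ of the Wasserstein 1-distance between the law of X_T and the Haar measure on the complex unit sphere is at most 2^{-c log n} = n^{-c}. -/

import Mathlib

open MeasureTheory

/-- A perfect matching of `Fin n`, encoded as a fixed-point-free involution. -/
def PerfectMatching (n : ℕ) : Type :=
  {σ : Equiv.Perm (Fin n) // (∀ i, σ (σ i) = i) ∧ ∀ i, σ i ≠ i}

instance (n : ℕ) : Fintype (PerfectMatching n) := by
  unfold PerfectMatching; infer_instance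

instance (n : ℕ) : MeasurableSpace (PerfectMatching n) := ⊤

/-- The uniform distribution on perfect matchings of `Fin n`. -/
noncomputable def uniformPM (n : ℕ) (h : Nonempty (PerfectMatching n)) :
    Measure (PerfectMatching n) :=
  (@PMF.uniformOfFintype (PerfectMatching n) _ h).toMeasure

/-- The uniform probability measure on the angle interval `[0, 2π)`. -/
noncomputable def uniformAngle : Measure ℝ :=
  (ENNReal.ofReal (2 * Real.pi))⁻¹ • (volume.restrict (Set.Ico 0 (2 * Real.pi)))

/-- The uniform probability measure on `[0, 1)`. -/
noncomputable def uniform01 : Measure ℝ := volume.restrict (Set.Ico 0 1)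

/-- Random seed for one step of the complex parallel Kac's walk: a perfect matching and, for each
pair (read off at the smaller index), phases `α, β ~ Unif[0,2π)` and `ζ ~ Unif[0,1)` (with
`θ = arcsin √ζ`) parameterizing a Haar-random `SU(2)` matrix. -/
abbrev CKacSeed (n : ℕ) : Type :=
  PerfectMatching n × (Fin n → ℝ) × (Fin n → ℝ) × (Fin n → ℝ)

/-- The distribution of one seed. -/
noncomputable def cKacSeedMeasure (n : ℕ) (h : Nonempty (PerfectMatching n)) :
    Measure (CKacSeed n) :=
  (uniformPM n h).prod
    ((Measure.pi fun _ : Fin n => uniformAngle).prod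
      ((Measure.pi fun _ : Fin n => uniformAngle).prod
        (Measure.pi fun _ : Fin n => uniform01)))

/-- One step of the complex parallel Kac's walk on `ℂ^n`: each matched pair `(i, j)` with `i < j`
and length `l = √(|v i|² + |v j|²)` is first rotated to `(l, 0)` by a suitable `SU(2)` matrix and
then multiplied by the Haar-random `SU(2)` matrix `U(α, β, θ)`, producing the pair
`(e^{iα} cos θ · l, e^{-iβ} sin θ · l)`. -/
noncomputable def cKacStep {n : ℕ} (s : CKacSeed n) (v : Fin n → ℂ) : Fin n → ℂ :=
  fun i =>
    let σ := s.1.1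
    let α := s.2.1
    let β := s.2.2.1
    let ζ := s.2.2.2
    let i0 := min i (σ i)
    let l : ℝ := Real.sqrt (Complex.normSq (v i0) + Complex.normSq (v (σ i0)))
    let θ : ℝ := Real.arcsin (Real.sqrt (ζ i0))
    if i ≤ σ i then Complex.exp (α i0 * Complex.I) * Real.cos θ * l
    else Complex.exp (-β i0 * Complex.I) * Real.sin θ * l

/-- The chain `X_T` after `T` steps of the complex parallel Kac's walk with the given seeds. -/
noncomputable def cKacWalk {n T : ℕ} (s : Fin T → CKacSeed n) (x0 : Fin n → ℂ) :
    Fin n → ℂ :=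
  (List.ofFn s).foldl (fun v seed => cKacStep seed v) x0

/-- The law of `X_T` started from `x0`, as a measure on `EuclideanSpace ℂ (Fin n)`. -/
noncomputable def cKacLaw (n T : ℕ) (h : Nonempty (PerfectMatching n)) (x0 : Fin n → ℂ)
    [MeasurableSpace (EuclideanSpace ℂ (Fin n))] :
    Measure (EuclideanSpace ℂ (Fin n)) :=
  (Measure.pi fun _ : Fin T => cKacSeedMeasure n h).map
    (fun s => (WithLp.equiv 2 (Fin n → ℂ)).symm (cKacWalk s x0))

/-- The Wasserstein 1-distance `W₁(μ, ν) = inf_γ E_{(x,y)∼γ} ‖x − y‖₂` over couplings `γ`. -/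
noncomputable def W1 {E : Type*} [MeasurableSpace E] [NormedAddCommGroup E]
    (μ ν : Measure E) : ℝ :=
  ⨅ γ : {γ : Measure (E × E) // γ.map Prod.fst = μ ∧ γ.map Prod.snd = ν},
    ∫ p, ‖p.1 - p.2‖ ∂γ.1

open scoped ENNReal

theorem lintegral_Ioo_eq_uniformAngle_sub {H : ℝ → ℝ≥0∞} (hH : Measurable H) :
    ∫⁻ θ in Set.Ioo (-Real.pi) Real.pi, H θ =
      ENNReal.ofReal (2 * Real.pi) * ∫⁻ α, H (α - Real.pi) ∂uniformAngle := by
  have hpi := Real.pi_pos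
  have h1 := (measurePreserving_sub_right (volume : Measure ℝ) Real.pi).setLIntegral_comp_preimage
    (s := Set.Ico (-Real.pi) Real.pi) measurableSet_Ico hH
  have h2 : (fun x : ℝ => x - Real.pi) ⁻¹' Set.Ico (-Real.pi) Real.pi
      = Set.Ico 0 (2 * Real.pi) := by
    ext x
    simp only [Set.mem_preimage, Set.mem_Ico]
    constructor <;> rintro ⟨_, _⟩ <;> constructor <;> linarith
  rw [h2] at h1
  rw [uniformAngle, lintegral_smul_measure, smul_eq_mul, ← mul_assoc, ENNReal.mul_inv_cancel,
    one_mul, h1]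
  · exact setLIntegral_congr Ioo_ae_eq_Ico
  · simpa using hpi
  · exact ENNReal.ofReal_ne_top

theorem lintegral_Ioo_eq_uniformAngle_sub_left {H : ℝ → ℝ≥0∞} (hH : Measurable H) :
    ∫⁻ θ in Set.Ioo (-Real.pi) Real.pi, H θ =
      ENNReal.ofReal (2 * Real.pi) * ∫⁻ α, H (Real.pi - α) ∂uniformAngle := by
  have h := (Measure.measurePreserving_neg (volume : Measure ℝ)).setLIntegral_comp_preimage
    (s := Set.Ioo (-Real.pi) Real.pi) measurableSet_Ioo hH
  have h2 : Neg.neg ⁻¹' Set.Ioo (-Real.pi) Real.pi = Set.Ioo (-Real.pi) Real.pi := by simp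
  rw [h2] at h
  rw [← h, lintegral_Ioo_eq_uniformAngle_sub (H := fun θ => H (-θ)) (by fun_prop)]
  simp

theorem lintegral_Ioi_ofReal_mul_sqrt {f : ℝ → ℝ≥0∞} :
    ∫⁻ s in Set.Ioi (0 : ℝ), f (Real.sqrt s) =
      ENNReal.ofReal 2 * ∫⁻ r in Set.Ioi (0 : ℝ), ENNReal.ofReal r * f r := by
  have h := lintegral_image_eq_lintegral_abs_deriv_mul (s := Set.Ioi (0 : ℝ)) (f := fun r => r ^ 2)
    (f' := fun r => 2 * r) measurableSet_Ioi
    (fun x _ => by simpa using (hasDerivAt_pow 2 x).hasDerivWithinAt)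
    (fun x hx y hy h => by
      simpa using (pow_left_inj₀ (le_of_lt hx) (le_of_lt hy) two_ne_zero).1 h)
    (fun s => f (Real.sqrt s))
  have himg : (fun r : ℝ => r ^ 2) '' Set.Ioi 0 = Set.Ioi 0 := by
    ext s
    simp only [Set.mem_image, Set.mem_Ioi]
    exact ⟨fun ⟨r, hr, h⟩ => h ▸ by positivity,
      fun hs => ⟨Real.sqrt s, Real.sqrt_pos.2 hs, Real.sq_sqrt hs.le⟩⟩
  rw [himg] at h
  rw [h, ← lintegral_const_mul' _ _ ENNReal.ofReal_ne_top]
  refine setLIntegral_congr_fun measurableSet_Ioi fun r hr => ?_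
  have hr' : (0 : ℝ) < r := hr
  rw [Real.sqrt_sq hr'.le, abs_of_pos (by positivity), ENNReal.ofReal_mul (by norm_num), mul_assoc]

theorem lintegral_complex_eq_polar {f : ℂ → ℝ≥0∞} (hf : Measurable f) :
    ∫⁻ z, f z = ∫⁻ θ in Set.Ioo (-Real.pi) Real.pi, ∫⁻ r in Set.Ioi (0 : ℝ),
      ENNReal.ofReal r * f (r * Complex.exp (θ * Complex.I)) := by
  rw [← Complex.lintegral_comp_polarCoord_symm, polarCoord_target, Measure.volume_eq_prod,
    setLIntegral_prod_symm]
  · simp [Complex.polarCoord_symm_apply, Complex.exp_mul_I]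
  · have : Measurable fun p : ℝ × ℝ => Complex.polarCoord.symm p := by
      simp only [Complex.polarCoord_symm_apply]; fun_prop
    simp only [smul_eq_mul]
    fun_prop

theorem measurable_lintegral_right {α β : Type*} [MeasurableSpace α] [MeasurableSpace β]
    {ν : Measure β} [SFinite ν] {f : α → β → ℝ≥0∞} (hf : Measurable fun p : α × β => f p.1 p.2) :
    Measurable fun x => ∫⁻ y, f x y ∂ν := Measurable.lintegral_prod_right hf

theorem half_mul_lintegral_Ioi {f : ℂ → ℝ≥0∞} (w : ℂ) :
    ∫⁻ r in Set.Ioi (0 : ℝ), ENNReal.ofReal r * f (r * w) =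
      ENNReal.ofReal (1 / 2) * ∫⁻ s in Set.Ioi (0 : ℝ), f (Real.sqrt s * w) := by
  rw [lintegral_Ioi_ofReal_mul_sqrt (f := fun r => f (r * w)), ← mul_assoc,
    ← ENNReal.ofReal_mul (by norm_num)]
  norm_num

theorem two_pi_mul_half (x : ℝ≥0∞) : ENNReal.ofReal (1 / 2) * (ENNReal.ofReal (2 * Real.pi) * x)
    = ENNReal.ofReal Real.pi * x := by
  rw [← mul_assoc, ← ENNReal.ofReal_mul (by norm_num)]
  congr 2; ring

theorem lintegral_complex_eq_uniformAngle {f : ℂ → ℝ≥0∞} (hf : Measurable f) :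
    ∫⁻ z, f z = ENNReal.ofReal Real.pi * ∫⁻ α : ℝ, (∫⁻ s in Set.Ioi (0 : ℝ),
      f (Real.sqrt s * Complex.exp (α * Complex.I))) ∂uniformAngle := by
  rw [← lintegral_neg_eq_self, lintegral_complex_eq_polar (by fun_prop)]
  simp only [half_mul_lintegral_Ioi (f := fun z => f (-z))]
  rw [lintegral_const_mul' _ _ ENNReal.ofReal_ne_top, lintegral_Ioo_eq_uniformAngle_sub,
    two_pi_mul_half]
  · simp [sub_mul, Complex.exp_sub, div_neg]
  · exact measurable_lintegral_right (by fun_prop)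

theorem lintegral_complex_eq_uniformAngle_neg {f : ℂ → ℝ≥0∞} (hf : Measurable f) :
    ∫⁻ z, f z = ENNReal.ofReal Real.pi * ∫⁻ α : ℝ, (∫⁻ s in Set.Ioi (0 : ℝ),
      f (Real.sqrt s * Complex.exp (-α * Complex.I))) ∂uniformAngle := by
  rw [← lintegral_neg_eq_self, lintegral_complex_eq_polar (by fun_prop)]
  simp only [half_mul_lintegral_Ioi (f := fun z => f (-z))]
  rw [lintegral_const_mul' _ _ ENNReal.ofReal_ne_top, lintegral_Ioo_eq_uniformAngle_sub_left,
    two_pi_mul_half]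
  · simp [sub_mul, Complex.exp_sub, Complex.exp_neg, div_eq_mul_inv]
  · exact measurable_lintegral_right (by fun_prop)

/-- If `(s₁, s₂)` is uniform on the simplex, `s₂ / (s₁ + s₂)` is uniform on `[0, 1]`. -/
theorem lintegral_simplex {k : ℝ → ℝ≥0∞} (hk : Measurable k) :
    ∫⁻ s₂ in Set.Ioi (0 : ℝ), ∫⁻ s₁ in Set.Ioi (0 : ℝ),
      (Set.Iic (1 : ℝ)).indicator (fun t => k (s₂ / t)) (s₁ + s₂) =
    (∫⁻ t in Set.Ioc (0 : ℝ) 1, ENNReal.ofReal t) * ∫⁻ ζ, k ζ ∂uniform01 := by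
  have hmk : Measurable fun p : ℝ × ℝ => (Set.Ioc (0 : ℝ) 1).indicator (fun t =>
      (Set.Ico 0 t).indicator (fun s => k (s / t)) p.1) p.2 := by
    have e : (fun p : ℝ × ℝ => (Set.Ioc (0 : ℝ) 1).indicator (fun t =>
      (Set.Ico 0 t).indicator (fun s => k (s / t)) p.1) p.2) =
      {p : ℝ × ℝ | (0 < p.2 ∧ p.2 ≤ 1) ∧ 0 ≤ p.1 ∧ p.1 < p.2}.indicator
        (fun p => k (p.1 / p.2)) := by
      ext p
      simp only [Set.indicator_apply, Set.mem_Ioc, Set.mem_Ico, Set.mem_ofPred_eq]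
      split_ifs <;> tauto
    rw [e]
    refine Measurable.indicator (by fun_prop) ?_
    refine ((measurableSet_lt measurable_const measurable_snd).inter
      (measurableSet_le measurable_snd measurable_const)).inter
      ((measurableSet_le measurable_const measurable_fst).inter
      (measurableSet_lt measurable_fst measurable_snd))
  have h1 : ∀ s₂ ∈ Set.Ioi (0 : ℝ), ∫⁻ s₁ in Set.Ioi (0 : ℝ),
      (Set.Iic (1 : ℝ)).indicator (fun t => k (s₂ / t)) (s₁ + s₂) =
      ∫⁻ t, (Set.Ioc (0 : ℝ) 1).indicator (fun t =>
        (Set.Ico 0 t).indicator (fun s => k (s / t)) s₂) t := by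
    intro s₂ hs₂
    have hs₂ : 0 < s₂ := hs₂
    rw [← lintegral_indicator measurableSet_Ioi]
    conv_rhs => rw [← lintegral_add_right_eq_self _ s₂]
    refine lintegral_congr fun s₁ => ?_
    simp only [Set.indicator_apply, Set.mem_Ioc, Set.mem_Ico, Set.mem_Ioi, Set.mem_Iic]
    split_ifs <;> first | rfl | (exfalso; grind)
  rw [setLIntegral_congr_fun measurableSet_Ioi h1, lintegral_lintegral_swap (by
    exact hmk.aemeasurable)]
  have h2 : ∀ t, ∫⁻ s in Set.Ioi (0:ℝ), (Set.Ioc (0 : ℝ) 1).indicator (fun t =>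
      (Set.Ico 0 t).indicator (fun s => k (s / t)) s) t =
      (Set.Ioc (0 : ℝ) 1).indicator (fun t => ENNReal.ofReal t * ∫⁻ ζ, k ζ ∂uniform01) t := by
    intro t
    by_cases ht : t ∈ Set.Ioc (0 : ℝ) 1
    · simp only [Set.indicator_of_mem ht]
      have ht0 : 0 < t := ht.1
      have h3 := lintegral_image_eq_lintegral_abs_deriv_mul (s := Set.Ico (0 : ℝ) 1)
        (f := fun ζ => t * ζ) (f' := fun _ => t) measurableSet_Ico
        (fun x _ => by simpa using ((hasDerivAt_id x).const_mul t).hasDerivWithinAt)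
        (fun x _ y _ h => mul_left_cancel₀ ht0.ne' h)
        (fun s => k (s / t))
      have himg : (fun ζ => t * ζ) '' Set.Ico (0 : ℝ) 1 = Set.Ico 0 t := by
        rw [Set.image_mul_left_Ico ht0]; simp
      rw [himg] at h3
      simp only [mul_div_cancel_left₀ _ ht0.ne', abs_of_pos ht0] at h3
      rw [lintegral_const_mul' _ _ ENNReal.ofReal_ne_top] at h3
      rw [uniform01, ← h3, setLIntegral_congr (Ioi_ae_eq_Ici),
        lintegral_indicator measurableSet_Ico, Measure.restrict_restrict measurableSet_Ico,
        Set.inter_eq_left.2 Set.Ico_subset_Ici_self]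
    · simp [Set.indicator_of_notMem ht]
  simp only [h2]
  rw [lintegral_indicator measurableSet_Ioc, lintegral_mul_const _ (by fun_prop)]

/-- The first column of the `SU(2)` matrix `U(α, β, θ)` with `θ = arcsin √ζ`. -/
noncomputable def su2Column (p : ℝ × ℝ × ℝ) : ℂ × ℂ :=
  (Complex.exp (p.1 * Complex.I) * Real.cos (Real.arcsin (Real.sqrt p.2.2)),
    Complex.exp (-p.2.1 * Complex.I) * Real.sin (Real.arcsin (Real.sqrt p.2.2)))

theorem measurable_su2Column : Measurable su2Column := by
  unfold su2Column
  have : Measurable Real.arcsin := Real.continuous_arcsin.measurable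
  fun_prop

instance isProbabilityMeasure_uniformAngle : IsProbabilityMeasure uniformAngle := by
  refine ⟨?_⟩
  rw [uniformAngle, Measure.smul_apply, Measure.restrict_apply_univ, Real.volume_Ico, sub_zero,
    smul_eq_mul, ENNReal.inv_mul_cancel]
  · simpa using Real.pi_pos
  · exact ENNReal.ofReal_ne_top

instance isProbabilityMeasure_uniform01 : IsProbabilityMeasure uniform01 :=
  ⟨by simp [uniform01]⟩

/-- The law of the first column of a Haar-random `SU(2)` matrix. -/
noncomputable def su2ColumnMeasure : Measure (ℂ × ℂ) :=
  (uniformAngle.prod (uniformAngle.prod uniform01)).map su2Column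

instance isProbabilityMeasure_su2ColumnMeasure : IsProbabilityMeasure su2ColumnMeasure :=
  Measure.isProbabilityMeasure_map measurable_su2Column.aemeasurable

/-- The squared Euclidean length of a pair of complex numbers. -/
noncomputable def pairNormSq (z : ℂ × ℂ) : ℝ := Complex.normSq z.1 + Complex.normSq z.2

theorem continuous_pairNormSq : Continuous pairNormSq := by
  unfold pairNormSq
  exact (Complex.continuous_normSq.comp continuous_fst).add
    (Complex.continuous_normSq.comp continuous_snd)

theorem pairNormSq_su2Column (p : ℝ × ℝ × ℝ) : pairNormSq (su2Column p) = 1 := by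
  have h : -(p.2.1 : ℂ) * Complex.I = ((-p.2.1 : ℝ) : ℂ) * Complex.I := by push_cast; ring
  simp only [pairNormSq, su2Column, Complex.normSq_mul, Complex.normSq_ofReal, h,
    Complex.normSq_eq_norm_sq (Complex.exp _), Complex.norm_exp_ofReal_mul_I]
  linear_combination Real.cos_sq_add_sin_sq (Real.arcsin √p.2.2)

/-- Rescaling of a nonzero pair to unit Euclidean length. -/
noncomputable def normalizePair (z : ℂ × ℂ) : ℂ × ℂ :=
  (((Real.sqrt (pairNormSq z))⁻¹ : ℝ) * z.1, ((Real.sqrt (pairNormSq z))⁻¹ : ℝ) * z.2)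

theorem measurable_normalizePair : Measurable normalizePair := by
  have := continuous_pairNormSq.measurable
  unfold normalizePair
  fun_prop

theorem pairNormSq_sqrt {s₁ s₂ : ℝ} (h₁ : 0 ≤ s₁) (h₂ : 0 ≤ s₂) (α β : ℝ) :
    pairNormSq (Real.sqrt s₁ * Complex.exp (α * Complex.I),
      Real.sqrt s₂ * Complex.exp (-β * Complex.I)) = s₁ + s₂ := by
  have h : -(β : ℂ) * Complex.I = ((-β : ℝ) : ℂ) * Complex.I := by push_cast; ring
  simp only [pairNormSq, Complex.normSq_mul, Complex.normSq_ofReal, h,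
    Complex.normSq_eq_norm_sq (Complex.exp _), Complex.norm_exp_ofReal_mul_I]
  rw [Real.mul_self_sqrt h₁, Real.mul_self_sqrt h₂]; ring

theorem normalizePair_sqrt {s₁ s₂ : ℝ} (h₁ : 0 < s₁) (h₂ : 0 < s₂) (α β : ℝ) :
    normalizePair (Real.sqrt s₁ * Complex.exp (α * Complex.I),
      Real.sqrt s₂ * Complex.exp (-β * Complex.I)) = su2Column (α, β, s₂ / (s₁ + s₂)) := by
  have hs : 0 < s₁ + s₂ := by positivity
  have h0 : 0 ≤ s₂ / (s₁ + s₂) := by positivity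
  have h1 : s₂ / (s₁ + s₂) ≤ 1 := by rw [div_le_one hs]; linarith
  have e1 : 1 - s₂ / (s₁ + s₂) = s₁ / (s₁ + s₂) := by field_simp; ring
  simp only [normalizePair, su2Column, pairNormSq_sqrt h₁.le h₂.le, Real.cos_arcsin]
  rw [Real.sin_arcsin (by linarith [Real.sqrt_nonneg (s₂ / (s₁ + s₂))]) (Real.sqrt_le_one.2 h1),
    Real.sq_sqrt h0, e1, Real.sqrt_div h₁.le, Real.sqrt_div h₂.le]
  ext <;> push_cast <;> ring

theorem lintegral_Ioc_ofReal_ne_top : ∫⁻ t in Set.Ioc (0 : ℝ) 1, ENNReal.ofReal t ≠ ∞ := by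
  refine ((setLIntegral_mono measurable_const (g := fun _ => 1) ?_).trans_lt ?_).ne
  · exact fun t ht => by simpa using ht.2
  · simp

theorem lintegral_unitBall_normalizePair {g : ℂ × ℂ → ℝ≥0∞} (hg : Measurable g) :
    ∫⁻ z in {z | pairNormSq z ≤ 1}, g (normalizePair z) =
      (ENNReal.ofReal Real.pi * (ENNReal.ofReal Real.pi *
        ∫⁻ t in Set.Ioc (0 : ℝ) 1, ENNReal.ofReal t)) * ∫⁻ w, g w ∂su2ColumnMeasure := by
  have hS : MeasurableSet {z : ℂ × ℂ | pairNormSq z ≤ 1} :=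
    measurableSet_le continuous_pairNormSq.measurable measurable_const
  rw [← lintegral_indicator hS]
  set Φ := {z : ℂ × ℂ | pairNormSq z ≤ 1}.indicator (fun z => g (normalizePair z)) with hΦ
  have hΦm : Measurable Φ := (hg.comp measurable_normalizePair).indicator hS
  have key : ∀ α β : ℝ, ∫⁻ s₂ in Set.Ioi (0 : ℝ), ∫⁻ s₁ in Set.Ioi (0 : ℝ),
      Φ (Real.sqrt s₁ * Complex.exp (α * Complex.I), Real.sqrt s₂ * Complex.exp (-β * Complex.I)) =
      (∫⁻ t in Set.Ioc (0 : ℝ) 1, ENNReal.ofReal t) *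
        ∫⁻ ζ, g (su2Column (α, β, ζ)) ∂uniform01 := by
    intro α β
    rw [← lintegral_simplex (k := fun ζ => g (su2Column (α, β, ζ)))
      (by have := measurable_su2Column; fun_prop)]
    refine setLIntegral_congr_fun measurableSet_Ioi fun s₂ h₂ => ?_
    refine setLIntegral_congr_fun measurableSet_Ioi fun s₁ h₁ => ?_
    have h₂ : 0 < s₂ := h₂
    have h₁ : 0 < s₁ := h₁
    simp only [hΦ, Set.indicator_apply, Set.mem_ofPred_eq, pairNormSq_sqrt h₁.le h₂.le,
      normalizePair_sqrt h₁ h₂, Set.mem_Iic]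
  calc ∫⁻ z, Φ z = ∫⁻ z₂, ∫⁻ z₁, Φ (z₁, z₂) := by
        rw [Measure.volume_eq_prod, lintegral_prod_symm _ hΦm.aemeasurable]
    _ = ENNReal.ofReal Real.pi * ∫⁻ β : ℝ, (∫⁻ s₂ in Set.Ioi (0 : ℝ),
        ENNReal.ofReal Real.pi * ∫⁻ α : ℝ, (∫⁻ s₁ in Set.Ioi (0 : ℝ),
        Φ (Real.sqrt s₁ * Complex.exp (α * Complex.I),
          Real.sqrt s₂ * Complex.exp (-β * Complex.I))) ∂uniformAngle) ∂uniformAngle := by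
        rw [lintegral_complex_eq_uniformAngle_neg]
        · congr! 6
          exact lintegral_complex_eq_uniformAngle (f := fun z => Φ (z, _)) (by fun_prop)
        · exact Measurable.lintegral_prod_left hΦm
    _ = ENNReal.ofReal Real.pi * (ENNReal.ofReal Real.pi * ∫⁻ β : ℝ, ∫⁻ α : ℝ,
        ((∫⁻ t in Set.Ioc (0 : ℝ) 1, ENNReal.ofReal t) *
        ∫⁻ ζ, g (su2Column (α, β, ζ)) ∂uniform01) ∂uniformAngle ∂uniformAngle) := by
        congr 1
        rw [← lintegral_const_mul' _ _ ENNReal.ofReal_ne_top]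
        refine lintegral_congr fun β => ?_
        rw [lintegral_const_mul' _ _ ENNReal.ofReal_ne_top, lintegral_lintegral_swap]
        · exact congrArg _ (lintegral_congr fun α => key α β)
        · refine Measurable.aemeasurable (measurable_lintegral_right (α := ℝ × ℝ) ?_)
          fun_prop
    _ = _ := by
        have hmc := measurable_su2Column
        have hm1 : Measurable fun p : ℝ × ℝ => ∫⁻ ζ, g (su2Column (p.1, p.2, ζ)) ∂uniform01 :=
          measurable_lintegral_right (α := ℝ × ℝ) (by fun_prop)
        rw [su2ColumnMeasure, lintegral_map hg measurable_su2Column,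
          lintegral_prod _ (by fun_prop)]
        have e : ∀ α : ℝ, ∫⁻ q, g (su2Column (α, q)) ∂(uniformAngle.prod uniform01) =
            ∫⁻ β, ∫⁻ ζ, g (su2Column (α, β, ζ)) ∂uniform01 ∂uniformAngle := fun α =>
          lintegral_prod _ (by fun_prop)
        simp only [e]
        simp only [lintegral_const_mul' _ _ lintegral_Ioc_ofReal_ne_top]
        rw [lintegral_lintegral_swap (f := fun β α => ∫⁻ ζ, g (su2Column (α, β, ζ)) ∂uniform01)
          (hm1.comp measurable_swap).aemeasurable]
        ring

/-- Identifying `ℂ × ℂ` with the quaternions, right multiplication by the quaternion `u`. -/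
noncomputable def quaternionMul (u : ℂ × ℂ) : ℂ × ℂ →ₗ[ℝ] ℂ × ℂ where
  toFun w := (u.1 * w.1 - u.2 * (starRingEnd ℂ) w.2, u.1 * w.2 + u.2 * (starRingEnd ℂ) w.1)
  map_add' w w' := by ext <;> simp only [Prod.fst_add, Prod.snd_add, map_add] <;> ring
  map_smul' r w := by
    ext <;> simp only [Prod.smul_fst, Prod.smul_snd, Complex.real_smul, map_mul,
      Complex.conj_ofReal, RingHom.id_apply] <;> ring

theorem quaternionMul_apply (u w : ℂ × ℂ) : quaternionMul u w =
    (u.1 * w.1 - u.2 * (starRingEnd ℂ) w.2, u.1 * w.2 + u.2 * (starRingEnd ℂ) w.1) := rfl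

theorem pairNormSq_quaternionMul (u w : ℂ × ℂ) :
    pairNormSq (quaternionMul u w) = pairNormSq u * pairNormSq w := by
  simp only [pairNormSq, quaternionMul_apply, Complex.normSq_apply, Complex.sub_re, Complex.sub_im,
    Complex.add_re, Complex.add_im, Complex.mul_re, Complex.mul_im, Complex.conj_re,
    Complex.conj_im]
  ring

theorem pairNormSq_eq_zero {w : ℂ × ℂ} (h : pairNormSq w = 0) : w = 0 := by
  unfold pairNormSq at h
  have h1 := Complex.normSq_nonneg w.1
  have h2 := Complex.normSq_nonneg w.2
  ext1
  · exact Complex.normSq_eq_zero.1 (by linarith)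
  · exact Complex.normSq_eq_zero.1 (by linarith)

theorem normalizePair_quaternionMul {u : ℂ × ℂ} (hu : pairNormSq u = 1) (w : ℂ × ℂ) :
    normalizePair (quaternionMul u w) = quaternionMul u (normalizePair w) := by
  simp only [normalizePair, pairNormSq_quaternionMul, hu, one_mul]
  ext <;> simp only [quaternionMul_apply, map_mul, Complex.conj_ofReal] <;> ring

theorem measurable_quaternionMul (u : ℂ × ℂ) : Measurable (quaternionMul u) :=
  (quaternionMul u).continuous_of_finiteDimensional.measurable

theorem measurePreserving_quaternionMul {u : ℂ × ℂ} (hu : pairNormSq u = 1) :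
    MeasurePreserving (quaternionMul u) su2ColumnMeasure su2ColumnMeasure := by
  have hR := measurable_quaternionMul u
  refine ⟨hR, Measure.ext_of_lintegral _ fun g hg => ?_⟩
  rw [lintegral_map hg hR]
  have : (volume : Measure (ℂ × ℂ)).IsAddHaarMeasure :=
    Measure.prod.instIsAddHaarMeasure volume volume
  have hdet : LinearMap.det (quaternionMul u) ≠ 0 := by
    rw [Ne, LinearMap.det_eq_zero_iff_ker_ne_bot, not_not, LinearMap.ker_eq_bot']
    intro w hw
    refine pairNormSq_eq_zero ?_
    have h := pairNormSq_quaternionMul u w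
    rw [hw, hu, one_mul] at h
    simpa [pairNormSq] using h.symm
  have hS : MeasurableSet {z : ℂ × ℂ | pairNormSq z ≤ 1} :=
    measurableSet_le continuous_pairNormSq.measurable measurable_const
  set K := ENNReal.ofReal Real.pi * (ENNReal.ofReal Real.pi *
        ∫⁻ t in Set.Ioc (0 : ℝ) 1, ENNReal.ofReal t)
  set c := ENNReal.ofReal |(LinearMap.det (quaternionMul u))⁻¹|
  have hscale : ∀ {g : ℂ × ℂ → ℝ≥0∞}, Measurable g →
      K * ∫⁻ w, g (quaternionMul u w) ∂su2ColumnMeasure =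
        c * (K * ∫⁻ w, g w ∂su2ColumnMeasure) := by
    intro g hg
    refine (lintegral_unitBall_normalizePair (hg.comp hR)).symm.trans ?_
    rw [← lintegral_unitBall_normalizePair hg,
      ← smul_eq_mul, ← lintegral_smul_measure, ← Measure.restrict_smul,
      ← Measure.map_linearMap_addHaar_eq_smul_addHaar _ hdet,
      Measure.restrict_map hR hS,
      lintegral_map (f := fun a => g (normalizePair a)) (hg.comp measurable_normalizePair) hR]
    simp only [normalizePair_quaternionMul hu, Set.preimage_ofPred_eq, pairNormSq_quaternionMul, hu,
      one_mul, Function.comp]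
  have hK0 : K ≠ 0 := by
    have h : 0 < ∫⁻ t in Set.Ioc (0 : ℝ) 1, ENNReal.ofReal t := by
      rw [setLIntegral_pos_iff (by fun_prop)]
      have : Function.support (fun t : ℝ => ENNReal.ofReal t) ∩ Set.Ioc 0 1 = Set.Ioc 0 1 := by
        ext t; simp +contextual
      simp [this]
    simp [K, h.ne', Real.pi_pos]
  have hKt : K ≠ ∞ := by
    have h := lintegral_Ioc_ofReal_ne_top
    finiteness
  have hone := hscale (g := fun _ => 1) measurable_const
  simp only [lintegral_const, measure_univ, mul_one] at hone
  refine (ENNReal.mul_right_inj hK0 hKt).1 ?_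
  rw [hscale hg, ← mul_assoc, ← hone]

namespace PerfectMatching

variable {n : ℕ} (σ : PerfectMatching n)

theorem apply_apply (i : Fin n) : σ.1 (σ.1 i) = i := σ.2.1 i

theorem not_le_iff (i : Fin n) : ¬ i ≤ σ.1 i ↔ σ.1 i ≤ σ.1 (σ.1 i) := by
  rw [σ.apply_apply]
  have := σ.2.2 i
  grind

theorem not_apply_le {i : Fin n} (h : i ≤ σ.1 i) : ¬ σ.1 i ≤ i :=
  fun h' => σ.2.2 i (le_antisymm h' h)

/-- Two functions with the same sums over matched pairs have the same sum. -/
theorem sum_congr {F G : Fin n → ℝ}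
    (h : ∀ i, i ≤ σ.1 i → F i + F (σ.1 i) = G i + G (σ.1 i)) : ∑ i, F i = ∑ i, G i := by
  have hall : ∀ i, F i + F (σ.1 i) = G i + G (σ.1 i) := by
    intro i
    by_cases hi : i ≤ σ.1 i
    · exact h i hi
    · have := h (σ.1 i) ((σ.not_le_iff i).1 hi)
      rw [σ.apply_apply] at this
      linarith
  have hsum := Finset.sum_congr (rfl : (Finset.univ : Finset (Fin n)) = _) fun i _ => hall i
  rw [Finset.sum_add_distrib, Finset.sum_add_distrib, Equiv.sum_comp σ.1 F,
    Equiv.sum_comp σ.1 G] at hsum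
  linarith

end PerfectMatching

/-- The step of the walk in terms of the first columns `w i` of the `SU(2)` matrices. -/
noncomputable def columnStep {n : ℕ} (σ : PerfectMatching n) (w : Fin n → ℂ × ℂ) (v : Fin n → ℂ) :
    Fin n → ℂ := fun i =>
  if i ≤ σ.1 i then (w i).1 * Real.sqrt (pairNormSq (v i, v (σ.1 i)))
  else (w (σ.1 i)).2 * Real.sqrt (pairNormSq (v (σ.1 i), v i))

/-- The first columns of the `SU(2)` matrices read off from a seed. -/
noncomputable def seedColumns {n : ℕ} (s : (Fin n → ℝ) × (Fin n → ℝ) × (Fin n → ℝ)) :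
    Fin n → ℂ × ℂ := fun i => su2Column (s.1 i, s.2.1 i, s.2.2 i)

theorem cKacStep_eq_columnStep {n : ℕ} (s : CKacSeed n) (v : Fin n → ℂ) :
    cKacStep s v = columnStep s.1 (seedColumns s.2) v := by
  ext i
  simp only [cKacStep, columnStep, seedColumns, su2Column, pairNormSq]
  split_ifs with h
  · rw [min_eq_left h]
  · rw [min_eq_right (not_le.1 h).le, s.1.apply_apply]

theorem columnStep_of_le {n : ℕ} {σ : PerfectMatching n} {i : Fin n} (h : i ≤ σ.1 i)
    (w : Fin n → ℂ × ℂ) (v : Fin n → ℂ) :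
    columnStep σ w v i = (w i).1 * Real.sqrt (pairNormSq (v i, v (σ.1 i))) := if_pos h

theorem columnStep_apply_of_le {n : ℕ} {σ : PerfectMatching n} {i : Fin n} (h : i ≤ σ.1 i)
    (w : Fin n → ℂ × ℂ) (v : Fin n → ℂ) :
    columnStep σ w v (σ.1 i) = (w i).2 * Real.sqrt (pairNormSq (v i, v (σ.1 i))) := by
  simp only [columnStep, σ.apply_apply, if_neg (σ.not_apply_le h)]

theorem measurePreserving_seedColumns (n : ℕ) : MeasurePreserving (seedColumns (n := n))
    ((Measure.pi fun _ => uniformAngle).prod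
      ((Measure.pi fun _ => uniformAngle).prod (Measure.pi fun _ => uniform01)))
    (Measure.pi fun _ => su2ColumnMeasure) := by
  have h1 := measurePreserving_arrowProdEquivProdArrow ℝ (ℝ × ℝ) (Fin n)
    (fun _ => uniformAngle) (fun _ => uniformAngle.prod uniform01)
  have h2 := measurePreserving_arrowProdEquivProdArrow ℝ ℝ (Fin n)
    (fun _ => uniformAngle) (fun _ => uniform01)
  have h3 := measurePreserving_pi (ι := Fin n)
    (fun _ => uniformAngle.prod (uniformAngle.prod uniform01))
    (fun _ => su2ColumnMeasure) (f := fun _ => su2Column)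
    fun _ => ⟨measurable_su2Column, rfl⟩
  exact h3.comp ((h1.symm _).comp ((MeasurePreserving.id _).prod (h2.symm _)))

/-- The unitary map acting on each matched pair by the `SU(2)` matrix with first column `w i`. -/
noncomputable def pairRotation {n : ℕ} (σ : PerfectMatching n) (w : Fin n → ℂ × ℂ) (v : Fin n → ℂ) :
    Fin n → ℂ := fun i =>
  if i ≤ σ.1 i then (w i).1 * v i - (starRingEnd ℂ) (w i).2 * v (σ.1 i)
  else (w (σ.1 i)).2 * v (σ.1 i) + (starRingEnd ℂ) (w (σ.1 i)).1 * v i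

theorem sum_normSq_pairRotation {n : ℕ} (σ : PerfectMatching n) {w : Fin n → ℂ × ℂ}
    (hw : ∀ i, pairNormSq (w i) = 1) (v : Fin n → ℂ) :
    ∑ i, Complex.normSq (pairRotation σ w v i) = ∑ i, Complex.normSq (v i) := by
  refine σ.sum_congr fun i hi => ?_
  have h := hw i
  simp only [pairRotation, if_pos hi, if_neg (σ.not_apply_le hi), σ.apply_apply]
  simp only [pairNormSq, Complex.normSq_apply] at h
  simp only [Complex.normSq_apply, Complex.sub_re, Complex.sub_im,
    Complex.add_re, Complex.add_im, Complex.mul_re, Complex.mul_im, Complex.conj_re,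
    Complex.conj_im]
  linear_combination ((v i).re ^ 2 + (v i).im ^ 2 + (v (σ.1 i)).re ^ 2 + (v (σ.1 i)).im ^ 2) * h

/-- `pairRotation` as a linear isometric equivalence of the Euclidean space. -/
noncomputable def pairRotationIsometry {n : ℕ} (σ : PerfectMatching n) {w : Fin n → ℂ × ℂ}
    (hw : ∀ i, pairNormSq (w i) = 1) :
    EuclideanSpace ℂ (Fin n) ≃ₗᵢ[ℂ] EuclideanSpace ℂ (Fin n) :=
  LinearIsometry.toLinearIsometryEquiv
    { toFun := fun v => WithLp.toLp 2 (pairRotation σ w v.ofLp)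
      map_add' := fun v v' => by
        ext i
        simp only [pairRotation, PiLp.add_apply]
        split_ifs <;> ring
      map_smul' := fun r v => by
        ext i
        simp only [pairRotation, PiLp.smul_apply, smul_eq_mul,
          RingHom.id_apply]
        split_ifs <;> ring
      norm_map' := fun v => by
        have h := sum_normSq_pairRotation σ hw v.ofLp
        simp only [Complex.normSq_eq_norm_sq] at h
        simp only [LinearMap.coe_mk, AddHom.coe_mk, EuclideanSpace.norm_eq, h] }
    rfl

theorem pairRotationIsometry_apply {n : ℕ} (σ : PerfectMatching n) {w : Fin n → ℂ × ℂ}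
    (hw : ∀ i, pairNormSq (w i) = 1) (v : EuclideanSpace ℂ (Fin n)) :
    pairRotationIsometry σ hw v = WithLp.toLp 2 (pairRotation σ w v.ofLp) := rfl

theorem exists_unit_pair (z : ℂ × ℂ) : ∃ u, pairNormSq u = 1 ∧
    u.1 * Real.sqrt (pairNormSq z) = z.1 ∧ u.2 * Real.sqrt (pairNormSq z) = z.2 := by
  by_cases h : pairNormSq z = 0
  · obtain rfl := pairNormSq_eq_zero h
    exact ⟨(1, 0), by simp [pairNormSq], by simp [pairNormSq]⟩
  · have hpos : 0 < pairNormSq z :=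
      lt_of_le_of_ne (add_nonneg (Complex.normSq_nonneg _) (Complex.normSq_nonneg _)) (Ne.symm h)
    have hs : ((Real.sqrt (pairNormSq z) : ℝ) : ℂ) ≠ 0 := by
      exact_mod_cast (Real.sqrt_pos.2 hpos).ne'
    refine ⟨normalizePair z, ?_, ?_, ?_⟩
    · simp only [normalizePair]
      simp only [pairNormSq, Complex.normSq_mul, Complex.normSq_ofReal]
      rw [← mul_add, ← mul_inv]
      change (√(pairNormSq z) * √(pairNormSq z))⁻¹ * pairNormSq z = 1
      rw [Real.mul_self_sqrt hpos.le, inv_mul_cancel₀ h]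
    · simp only [normalizePair, Complex.ofReal_inv]; field_simp
    · simp only [normalizePair, Complex.ofReal_inv]; field_simp

theorem columnStep_quaternionMul {n : ℕ} (σ : PerfectMatching n) (v : Fin n → ℂ)
    {u : Fin n → ℂ × ℂ}
    (h₁ : ∀ i, (u i).1 * Real.sqrt (pairNormSq (v i, v (σ.1 i))) = v i)
    (h₂ : ∀ i, (u i).2 * Real.sqrt (pairNormSq (v i, v (σ.1 i))) = v (σ.1 i))
    (w : Fin n → ℂ × ℂ) :
    columnStep σ (fun i => quaternionMul (u i) (w i)) v = pairRotation σ w v := by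
  ext i
  have h₁' := h₁ (σ.1 i)
  have h₂' := h₂ (σ.1 i)
  rw [σ.apply_apply] at h₁' h₂'
  simp only [columnStep, pairRotation, quaternionMul_apply]
  split_ifs
  · linear_combination (w i).1 * h₁ i - (starRingEnd ℂ) (w i).2 * h₂ i
  · linear_combination (w (σ.1 i)).2 * h₁' + (starRingEnd ℂ) (w (σ.1 i)).1 * h₂'

theorem measurable_columnStep {n : ℕ} (σ : PerfectMatching n) :
    Measurable fun p : (Fin n → ℂ × ℂ) × (Fin n → ℂ) => columnStep σ p.1 p.2 := by
  have := continuous_pairNormSq.measurable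
  refine measurable_pi_iff.2 fun i => ?_
  simp only [columnStep]
  split_ifs <;> fun_prop

theorem ae_pairNormSq_eq_one (n : ℕ) :
    ∀ᵐ w ∂(Measure.pi fun _ : Fin n => su2ColumnMeasure), ∀ i, pairNormSq (w i) = 1 := by
  have h : ∀ᵐ w ∂su2ColumnMeasure, pairNormSq w = 1 := by
    rw [su2ColumnMeasure, ae_map_iff measurable_su2Column.aemeasurable
      (measurableSet_eq_fun continuous_pairNormSq.measurable measurable_const)]
    exact Filter.Eventually.of_forall pairNormSq_su2Column
  exact ae_all_iff.2 fun i =>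
    (measurePreserving_eval (fun _ : Fin n => su2ColumnMeasure) i).quasiMeasurePreserving.ae h

theorem lintegral_columnStep {n : ℕ} (σ : PerfectMatching n)
    {μ : Measure (EuclideanSpace ℂ (Fin n))} [IsProbabilityMeasure μ]
    (hμ : ∀ U : EuclideanSpace ℂ (Fin n) ≃ₗᵢ[ℂ] EuclideanSpace ℂ (Fin n), μ.map U = μ)
    {f : EuclideanSpace ℂ (Fin n) → ℝ≥0∞} (hf : Measurable f) :
    ∫⁻ y, ∫⁻ w, f (WithLp.toLp 2 (columnStep σ w y.ofLp))
      ∂(Measure.pi fun _ : Fin n => su2ColumnMeasure) ∂μ = ∫⁻ y, f y ∂μ := by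
  have hstep := measurable_columnStep σ
  have hrot : Measurable fun p : EuclideanSpace ℂ (Fin n) × (Fin n → ℂ × ℂ) =>
      pairRotation σ p.2 p.1.ofLp := by
    refine measurable_pi_iff.2 fun i => ?_
    simp only [pairRotation]
    split_ifs <;> fun_prop
  have h1 : ∀ y : EuclideanSpace ℂ (Fin n), ∫⁻ w, f (WithLp.toLp 2 (columnStep σ w y.ofLp))
      ∂(Measure.pi fun _ : Fin n => su2ColumnMeasure) =
      ∫⁻ w, f (WithLp.toLp 2 (pairRotation σ w y.ofLp))
        ∂(Measure.pi fun _ : Fin n => su2ColumnMeasure) := by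
    intro y
    choose u hu h₁ h₂ using fun i => exists_unit_pair (y.ofLp i, y.ofLp (σ.1 i))
    have hmp := measurePreserving_pi (fun _ : Fin n => su2ColumnMeasure)
      (fun _ => su2ColumnMeasure) (f := fun i => quaternionMul (u i))
      fun i => measurePreserving_quaternionMul (hu i)
    rw [← hmp.lintegral_comp (by fun_prop)]
    simp only [columnStep_quaternionMul σ y.ofLp h₁ h₂]
  simp only [h1]
  rw [lintegral_lintegral_swap (Measurable.aemeasurable (by unfold Function.uncurry; fun_prop))]
  have h2 : ∀ᵐ w ∂(Measure.pi fun _ : Fin n => su2ColumnMeasure),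
      ∫⁻ y, f (WithLp.toLp 2 (pairRotation σ w y.ofLp)) ∂μ = ∫⁻ y, f y ∂μ := by
    filter_upwards [ae_pairNormSq_eq_one n] with w hw
    conv_rhs => rw [← hμ (pairRotationIsometry σ hw)]
    rw [lintegral_map hf (pairRotationIsometry σ hw).continuous.measurable]
    simp only [pairRotationIsometry_apply]
  rw [lintegral_congr_ae h2]
  simp

theorem measurable_seedColumns {n : ℕ} : Measurable (seedColumns (n := n)) :=
  (measurePreserving_seedColumns n).measurable

instance discreteMeasurableSpace_perfectMatching (n : ℕ) :
    DiscreteMeasurableSpace (PerfectMatching n) := ⟨fun _ => trivial⟩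

instance isProbabilityMeasure_uniformPM (n : ℕ) (h : Nonempty (PerfectMatching n)) :
    IsProbabilityMeasure (uniformPM n h) := by
  unfold uniformPM; infer_instance

instance isProbabilityMeasure_cKacSeedMeasure (n : ℕ) (h : Nonempty (PerfectMatching n)) :
    IsProbabilityMeasure (cKacSeedMeasure n h) := by
  unfold cKacSeedMeasure; infer_instance

theorem measurable_cKacStep {n : ℕ} :
    Measurable fun p : CKacSeed n × (Fin n → ℂ) => cKacStep p.1 p.2 := by
  have hg : Measurable fun q : PerfectMatching n ×
      (((Fin n → ℝ) × (Fin n → ℝ) × (Fin n → ℝ)) × (Fin n → ℂ)) =>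
      columnStep q.1 (seedColumns q.2.1) q.2.2 :=
    measurable_from_prod_countable_right fun σ => by
      have h2 := measurable_seedColumns (n := n)
      exact (measurable_columnStep σ).comp
        ((h2.comp measurable_fst).prodMk measurable_snd)
  simp only [cKacStep_eq_columnStep]
  exact hg.comp ((measurable_fst.comp measurable_fst).prodMk
    ((measurable_snd.comp measurable_fst).prodMk measurable_snd))

/-- Integration against a seed: first the matching, then the columns of the matrices. -/
theorem lintegral_cKacSeedMeasure {n : ℕ} (h : Nonempty (PerfectMatching n))
    {G : PerfectMatching n → (Fin n → ℂ × ℂ) → ℝ≥0∞} (hG : ∀ σ, Measurable (G σ)) :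
    ∫⁻ s, G s.1 (seedColumns s.2) ∂cKacSeedMeasure n h = ∫⁻ σ, ∫⁻ w, G σ w
      ∂(Measure.pi fun _ : Fin n => su2ColumnMeasure) ∂uniformPM n h := by
  rw [cKacSeedMeasure, lintegral_prod _ (measurable_from_prod_countable_right fun σ =>
    (hG σ).comp measurable_seedColumns).aemeasurable]
  exact lintegral_congr fun σ => (measurePreserving_seedColumns n).lintegral_comp (hG σ)

theorem lintegral_cKacStep {n : ℕ} (h : Nonempty (PerfectMatching n))
    {μ : Measure (EuclideanSpace ℂ (Fin n))} [IsProbabilityMeasure μ]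
    (hμ : ∀ U : EuclideanSpace ℂ (Fin n) ≃ₗᵢ[ℂ] EuclideanSpace ℂ (Fin n), μ.map U = μ)
    {f : EuclideanSpace ℂ (Fin n) → ℝ≥0∞} (hf : Measurable f) :
    ∫⁻ y, ∫⁻ s, f (WithLp.toLp 2 (cKacStep s y.ofLp)) ∂cKacSeedMeasure n h ∂μ = ∫⁻ y, f y ∂μ := by
  have hc := measurable_columnStep (n := n)
  simp only [cKacStep_eq_columnStep]
  simp only [fun y : EuclideanSpace ℂ (Fin n) => lintegral_cKacSeedMeasure h
    (G := fun σ w => f (WithLp.toLp 2 (columnStep σ w y.ofLp))) fun σ => by fun_prop]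
  rw [lintegral_lintegral_swap]
  · simp only [lintegral_columnStep _ hμ hf, lintegral_const, measure_univ, mul_one]
  · refine Measurable.aemeasurable (measurable_from_prod_countable_left fun σ => ?_)
    have := measurable_columnStep σ
    refine measurable_lintegral_right ?_
    dsimp only
    fun_prop

theorem cKacWalk_zero {n : ℕ} (s : Fin 0 → CKacSeed n) (v : Fin n → ℂ) : cKacWalk s v = v := by
  simp [cKacWalk]

theorem cKacWalk_succ {n T : ℕ} (s : Fin (T + 1) → CKacSeed n) (v : Fin n → ℂ) :
    cKacWalk s v = cKacWalk (fun i => s i.succ) (cKacStep (s 0) v) := by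
  simp [cKacWalk, List.ofFn_succ]

theorem cKacWalk_succ_last {n T : ℕ} (s : Fin (T + 1) → CKacSeed n) (v : Fin n → ℂ) :
    cKacWalk s v = cKacStep (s (Fin.last T)) (cKacWalk (fun i => s i.castSucc) v) := by
  rw [cKacWalk, List.ofFn_succ', List.concat_eq_append, List.foldl_append]
  rfl

theorem measurable_cKacWalk {n : ℕ} (T : ℕ) :
    Measurable fun p : (Fin T → CKacSeed n) × (Fin n → ℂ) => cKacWalk p.1 p.2 := by
  induction T with
  | zero => simpa only [cKacWalk_zero] using measurable_snd
  | succ T ih =>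
    have := measurable_cKacStep (n := n)
    simp only [cKacWalk_succ]
    have h1 : Measurable fun p : (Fin (T + 1) → CKacSeed n) × (Fin n → ℂ) =>
        cKacStep (p.1 0) p.2 := by fun_prop
    have h2 : Measurable fun p : (Fin (T + 1) → CKacSeed n) × (Fin n → ℂ) =>
        fun i : Fin T => p.1 i.succ := by fun_prop
    exact ih.comp (h2.prodMk h1)

theorem lintegral_pi_succ {α : Type*} [MeasurableSpace α] (ρ : Measure α) [SigmaFinite ρ] {T : ℕ}
    {F : α → (Fin T → α) → ℝ≥0∞} (hF : Measurable fun p : α × (Fin T → α) => F p.1 p.2) :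
    ∫⁻ s, F (s 0) (fun i => s i.succ) ∂(Measure.pi fun _ : Fin (T + 1) => ρ) =
      ∫⁻ a, ∫⁻ t, F a t ∂(Measure.pi fun _ : Fin T => ρ) ∂ρ := by
  have h := measurePreserving_piFinSuccAbove (fun _ : Fin (T + 1) => ρ) 0
  rw [← lintegral_prod (fun p : α × (Fin T → α) => F p.1 p.2) hF.aemeasurable,
    ← h.lintegral_comp hF]
  rfl

theorem lintegral_cKacWalk {n : ℕ} (h : Nonempty (PerfectMatching n)) (T : ℕ)
    {μ : Measure (EuclideanSpace ℂ (Fin n))} [IsProbabilityMeasure μ]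
    (hμ : ∀ U : EuclideanSpace ℂ (Fin n) ≃ₗᵢ[ℂ] EuclideanSpace ℂ (Fin n), μ.map U = μ)
    {f : EuclideanSpace ℂ (Fin n) → ℝ≥0∞} (hf : Measurable f) :
    ∫⁻ y, ∫⁻ s, f (WithLp.toLp 2 (cKacWalk s y.ofLp))
      ∂(Measure.pi fun _ : Fin T => cKacSeedMeasure n h) ∂μ = ∫⁻ y, f y ∂μ := by
  induction T with
  | zero => simp [cKacWalk_zero]
  | succ T ih =>
    have hw := measurable_cKacWalk (n := n) T
    have hs := measurable_cKacStep (n := n)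
    have h1 : ∀ y : EuclideanSpace ℂ (Fin n), ∫⁻ s, f (WithLp.toLp 2 (cKacWalk s y.ofLp))
        ∂(Measure.pi fun _ : Fin (T + 1) => cKacSeedMeasure n h) =
        ∫⁻ a, ∫⁻ t, f (WithLp.toLp 2 (cKacWalk t (cKacStep a y.ofLp)))
          ∂(Measure.pi fun _ : Fin T => cKacSeedMeasure n h) ∂cKacSeedMeasure n h := by
      intro y
      simp only [cKacWalk_succ]
      exact lintegral_pi_succ _
        (F := fun a t => f (WithLp.toLp 2 (cKacWalk t (cKacStep a y.ofLp)))) (by fun_prop)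
    simp only [h1]
    rw [← ih]
    exact lintegral_cKacStep h hμ (f := fun z => ∫⁻ t, f (WithLp.toLp 2 (cKacWalk t z.ofLp))
      ∂(Measure.pi fun _ : Fin T => cKacSeedMeasure n h)) (measurable_lintegral_right (by fun_prop))

/-- The coupling distance `∑ᵢ (|vᵢ|² - |wᵢ|²)²`. -/
noncomputable def normSqDist {n : ℕ} (v w : Fin n → ℂ) : ℝ :=
  ∑ i, (Complex.normSq (v i) - Complex.normSq (w i)) ^ 2

theorem normSqDist_nonneg {n : ℕ} (v w : Fin n → ℂ) : 0 ≤ normSqDist v w :=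
  Finset.sum_nonneg fun _ _ => sq_nonneg _

theorem measurable_normSqDist {n : ℕ} :
    Measurable fun p : (Fin n → ℂ) × (Fin n → ℂ) => normSqDist p.1 p.2 := by
  have := Complex.continuous_normSq.measurable
  unfold normSqDist
  fun_prop

namespace PerfectMatching

variable {n : ℕ}

/-- Conjugation of a perfect matching by the transposition of `j` and `k`. -/
def conjSwap (j k : Fin n) (σ : PerfectMatching n) : PerfectMatching n :=
  ⟨((Equiv.swap j k).trans σ.1).trans (Equiv.swap j k), fun i => by
    simp [σ.apply_apply], fun i hi => by
    simp only [Equiv.trans_apply] at hi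
    exact σ.2.2 _ (by rw [← Equiv.swap_apply_eq_iff, hi])⟩

theorem conjSwap_involutive (j k : Fin n) : Function.Involutive (conjSwap j k) := fun σ => by
  apply Subtype.ext; ext i; simp [conjSwap]

theorem sum_ite_apply_eq {i j k : Fin n} (hj : j ≠ i) (hk : k ≠ i) :
    ∑ σ : PerfectMatching n, (if σ.1 i = j then (1 : ℝ) else 0) =
      ∑ σ : PerfectMatching n, if σ.1 i = k then (1 : ℝ) else 0 := by
  rw [← Equiv.sum_comp (Function.Involutive.toPerm (conjSwap j k) (conjSwap_involutive j k))]
  refine Finset.sum_congr rfl fun σ _ => ?_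
  have h : (Function.Involutive.toPerm (conjSwap j k) (conjSwap_involutive j k) σ).1 i =
      Equiv.swap j k (σ.1 i) := by
    simp [conjSwap, Equiv.swap_apply_of_ne_of_ne hj.symm hk.symm]
  simp only [h, Equiv.swap_apply_eq_iff, Equiv.swap_apply_left]

theorem sum_mul_sum_apply_nonpos {d : Fin n → ℝ} (hd : ∑ i, d i = 0) (i : Fin n) :
    d i * ∑ σ : PerfectMatching n, d (σ.1 i) ≤ 0 := by
  set N : Fin n → ℝ := fun j => ∑ σ : PerfectMatching n, if σ.1 i = j then (1 : ℝ) else 0 with hN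
  have hN0 : ∀ j, 0 ≤ N j := fun j => Finset.sum_nonneg fun _ _ => by split_ifs <;> norm_num
  have hNi : N i = 0 := Finset.sum_eq_zero fun σ _ => if_neg (σ.2.2 i)
  have h1 : ∑ σ : PerfectMatching n, d (σ.1 i) = ∑ j, N j * d j := by
    simp only [hN, Finset.sum_mul]
    rw [Finset.sum_comm]
    simp
  have h2 : ∃ c, 0 ≤ c ∧ ∀ j, j ≠ i → N j = c := by
    by_cases h : ∃ j, j ≠ i
    · obtain ⟨j, hj⟩ := h
      exact ⟨N j, hN0 j, fun k hk => sum_ite_apply_eq hk hj⟩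
    · exact ⟨0, le_rfl, fun j hj => absurd ⟨j, hj⟩ h⟩
  obtain ⟨c, hc, hNc⟩ := h2
  have h3 : ∀ j, N j * d j = c * d j - if j = i then c * d i else 0 := by
    intro j
    split_ifs with hji
    · rw [hji, hNi]; ring
    · rw [hNc j hji]; ring
  rw [h1, Finset.sum_congr rfl fun j _ => h3 j, Finset.sum_sub_distrib, ← Finset.mul_sum, hd]
  simp only [mul_zero, Finset.sum_ite_eq', Finset.mem_univ, if_true]
  nlinarith [mul_nonneg hc (mul_self_nonneg (d i))]

/-- Averaging over the matching contracts pairwise sums of a mean-zero vector. -/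
theorem sum_sum_sq_add_le {d : Fin n → ℝ} (hd : ∑ i, d i = 0) :
    ∑ σ : PerfectMatching n, ∑ i, (d i + d (σ.1 i)) ^ 2 ≤
      Fintype.card (PerfectMatching n) * (2 * ∑ i, d i ^ 2) := by
  have h1 : ∀ σ : PerfectMatching n, ∑ i, (d i + d (σ.1 i)) ^ 2 =
      2 * ∑ i, d i ^ 2 + 2 * ∑ i, d i * d (σ.1 i) := by
    intro σ
    have h := Equiv.sum_comp σ.1 (fun i => d i ^ 2)
    have e : ∀ i, (d i + d (σ.1 i)) ^ 2 = d i ^ 2 + d (σ.1 i) ^ 2 + 2 * (d i * d (σ.1 i)) :=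
      fun i => by ring
    simp only [e, Finset.sum_add_distrib, ← Finset.mul_sum, h]
    ring
  have h2 : ∑ σ : PerfectMatching n, ∑ i, d i * d (σ.1 i) =
      ∑ i, d i * ∑ σ : PerfectMatching n, d (σ.1 i) := by
    rw [Finset.sum_comm]; simp only [Finset.mul_sum]
  rw [Finset.sum_congr rfl fun σ _ => h1 σ, Finset.sum_add_distrib,
    ← Finset.mul_sum _ (fun σ : PerfectMatching n => ∑ i, d i * d (σ.1 i)), h2,
    Finset.sum_const, Finset.card_univ, nsmul_eq_mul]
  have := Finset.sum_nonpos fun i (_ : i ∈ Finset.univ) => sum_mul_sum_apply_nonpos hd i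
  linarith

end PerfectMatching

theorem lintegral_uniform01_ofReal {p : ℝ → ℝ} (hp : Continuous p) (hp0 : ∀ x, 0 ≤ p x) :
    ∫⁻ ζ, ENNReal.ofReal (p ζ) ∂uniform01 = ENNReal.ofReal (∫ ζ in (0 : ℝ)..1, p ζ) := by
  rw [uniform01, setLIntegral_congr Ico_ae_eq_Ioc, intervalIntegral.integral_of_le zero_le_one,
    ofReal_integral_eq_lintegral_ofReal
      ((hp.integrableOn_Icc (a := 0) (b := 1)).mono_set Set.Ioc_subset_Icc_self)
      (Filter.Eventually.of_forall hp0)]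

theorem lintegral_su2ColumnMeasure_normSq {F : ℂ × ℂ → ℝ} (hF : Measurable F) {p : ℝ → ℝ}
    (hp : Continuous p) (hp0 : ∀ x, 0 ≤ p x)
    (h : ∀ α β : ℝ, ∀ ζ ∈ Set.Ico (0 : ℝ) 1, F (su2Column (α, β, ζ)) = p ζ) :
    ∫⁻ w, ENNReal.ofReal (F w) ∂su2ColumnMeasure = ENNReal.ofReal (∫ ζ in (0 : ℝ)..1, p ζ) := by
  have hmc := measurable_su2Column
  rw [su2ColumnMeasure, lintegral_map (by fun_prop) hmc, lintegral_prod _ (by fun_prop)]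
  have e : ∀ α : ℝ, ∫⁻ q, ENNReal.ofReal (F (su2Column (α, q))) ∂(uniformAngle.prod uniform01) =
      ENNReal.ofReal (∫ ζ in (0 : ℝ)..1, p ζ) := by
    intro α
    rw [lintegral_prod _ (by fun_prop)]
    have e2 : ∀ β : ℝ, ∫⁻ ζ, ENNReal.ofReal (F (su2Column (α, β, ζ))) ∂uniform01 =
        ENNReal.ofReal (∫ ζ in (0 : ℝ)..1, p ζ) := by
      intro β
      rw [← lintegral_uniform01_ofReal hp hp0]
      exact setLIntegral_congr_fun measurableSet_Ico fun ζ hζ => by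
        simp only [h α β ζ hζ]
    simp [e2]
  simp [e]

theorem normSq_su2Column_snd (α β : ℝ) {ζ : ℝ} (hζ : ζ ∈ Set.Ico (0 : ℝ) 1) :
    Complex.normSq (su2Column (α, β, ζ)).2 = ζ := by
  have h : -(β : ℂ) * Complex.I = ((-β : ℝ) : ℂ) * Complex.I := by push_cast; ring
  simp only [su2Column, Complex.normSq_mul, Complex.normSq_ofReal, h,
    Complex.normSq_eq_norm_sq (Complex.exp _), Complex.norm_exp_ofReal_mul_I]
  rw [Real.sin_arcsin (by linarith [Real.sqrt_nonneg ζ]) (Real.sqrt_le_one.2 hζ.2.le),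
    Real.mul_self_sqrt hζ.1]
  ring

theorem normSq_su2Column_fst (α β : ℝ) {ζ : ℝ} (hζ : ζ ∈ Set.Ico (0 : ℝ) 1) :
    Complex.normSq (su2Column (α, β, ζ)).1 = 1 - ζ := by
  have h := pairNormSq_su2Column (α, β, ζ)
  rw [pairNormSq, normSq_su2Column_snd α β hζ] at h
  linarith

theorem lintegral_normSq_fst_sq :
    ∫⁻ w, ENNReal.ofReal (Complex.normSq w.1 ^ 2) ∂su2ColumnMeasure = ENNReal.ofReal (1 / 3) := by
  have := Complex.continuous_normSq.measurable
  rw [lintegral_su2ColumnMeasure_normSq (p := fun ζ => (1 - ζ) ^ 2) (by fun_prop) (by fun_prop)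
    (fun x => sq_nonneg _) fun α β ζ hζ => by rw [normSq_su2Column_fst α β hζ]]
  congr 1
  rw [intervalIntegral.integral_comp_sub_left (fun x => x ^ 2)]
  norm_num

theorem lintegral_normSq_snd_sq :
    ∫⁻ w, ENNReal.ofReal (Complex.normSq w.2 ^ 2) ∂su2ColumnMeasure = ENNReal.ofReal (1 / 3) := by
  have := Complex.continuous_normSq.measurable
  rw [lintegral_su2ColumnMeasure_normSq (p := fun ζ => ζ ^ 2) (by fun_prop) (by fun_prop)
    (fun x => sq_nonneg _) fun α β ζ hζ => by rw [normSq_su2Column_snd α β hζ]]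
  norm_num

theorem pairNormSq_nonneg (z : ℂ × ℂ) : 0 ≤ pairNormSq z :=
  add_nonneg (Complex.normSq_nonneg _) (Complex.normSq_nonneg _)

theorem normSq_mul_sqrt_pairNormSq (a : ℂ) (z : ℂ × ℂ) :
    Complex.normSq (a * Real.sqrt (pairNormSq z)) = Complex.normSq a * pairNormSq z := by
  rw [Complex.normSq_mul, Complex.normSq_ofReal, Real.mul_self_sqrt (pairNormSq_nonneg z)]

theorem lintegral_normSqDist_columnStep {n : ℕ} (σ : PerfectMatching n) (v w : Fin n → ℂ) :
    ∫⁻ c, ENNReal.ofReal (normSqDist (columnStep σ c v) (columnStep σ c w))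
      ∂(Measure.pi fun _ : Fin n => su2ColumnMeasure) =
    ENNReal.ofReal (1 / 3 * ∑ i, ((Complex.normSq (v i) - Complex.normSq (w i)) +
      (Complex.normSq (v (σ.1 i)) - Complex.normSq (w (σ.1 i)))) ^ 2) := by
  have hm := measurable_columnStep σ
  have hn := Complex.continuous_normSq.measurable
  simp only [normSqDist]
  simp only [ENNReal.ofReal_sum_of_nonneg fun i (_ : i ∈ Finset.univ) => sq_nonneg _]
  rw [lintegral_finsetSum _ fun i _ => by fun_prop, Finset.mul_sum,
    ENNReal.ofReal_sum_of_nonneg fun i _ => by positivity]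
  refine Finset.sum_congr rfl fun i _ => ?_
  set D := (Complex.normSq (v i) - Complex.normSq (w i)) +
      (Complex.normSq (v (σ.1 i)) - Complex.normSq (w (σ.1 i)))
  have heval := fun j => measurePreserving_eval (fun _ : Fin n => su2ColumnMeasure) j
  rw [ENNReal.ofReal_mul (by norm_num)]
  by_cases hi : i ≤ σ.1 i
  · have e : ∀ c : Fin n → ℂ × ℂ, ENNReal.ofReal ((Complex.normSq (columnStep σ c v i) -
        Complex.normSq (columnStep σ c w i)) ^ 2) =
        ENNReal.ofReal (Complex.normSq (c i).1 ^ 2) * ENNReal.ofReal (D ^ 2) := by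
      intro c
      rw [← ENNReal.ofReal_mul (by positivity)]
      simp only [columnStep, if_pos hi, normSq_mul_sqrt_pairNormSq]
      simp only [pairNormSq, D]
      congr 1; ring
    simp only [e]
    rw [lintegral_mul_const _ (by fun_prop), ← lintegral_normSq_fst_sq,
      ← (heval i).lintegral_comp (by fun_prop)]
  · have e : ∀ c : Fin n → ℂ × ℂ, ENNReal.ofReal ((Complex.normSq (columnStep σ c v i) -
        Complex.normSq (columnStep σ c w i)) ^ 2) =
        ENNReal.ofReal (Complex.normSq (c (σ.1 i)).2 ^ 2) * ENNReal.ofReal (D ^ 2) := by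
      intro c
      rw [← ENNReal.ofReal_mul (by positivity)]
      simp only [columnStep, if_neg hi, normSq_mul_sqrt_pairNormSq]
      simp only [pairNormSq, D]
      congr 1; ring
    simp only [e]
    rw [lintegral_mul_const _ (by fun_prop), ← lintegral_normSq_snd_sq,
      ← (heval (σ.1 i)).lintegral_comp (by fun_prop)]

theorem lintegral_uniformPM_ofReal {n : ℕ} (h : Nonempty (PerfectMatching n))
    {F : PerfectMatching n → ℝ} (hF : ∀ σ, 0 ≤ F σ) :
    ∫⁻ σ, ENNReal.ofReal (F σ) ∂uniformPM n h =
      ENNReal.ofReal ((∑ σ, F σ) / Fintype.card (PerfectMatching n)) := by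
  have hc : (0 : ℝ) < Fintype.card (PerfectMatching n) := by exact_mod_cast Fintype.card_pos
  rw [lintegral_fintype, Finset.sum_div, ENNReal.ofReal_sum_of_nonneg fun σ _ =>
    div_nonneg (hF σ) hc.le]
  refine Finset.sum_congr rfl fun σ _ => ?_
  rw [uniformPM, PMF.toMeasure_apply_singleton _ _ (measurableSet_singleton σ),
    PMF.uniformOfFintype_apply, ENNReal.ofReal_div_of_pos hc, ENNReal.ofReal_natCast,
    div_eq_mul_inv]

theorem lintegral_normSqDist_cKacStep_le {n : ℕ} (h : Nonempty (PerfectMatching n))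
    {v w : Fin n → ℂ} (hvw : ∑ i, Complex.normSq (v i) = ∑ i, Complex.normSq (w i)) :
    ∫⁻ s, ENNReal.ofReal (normSqDist (cKacStep s v) (cKacStep s w)) ∂cKacSeedMeasure n h ≤
      ENNReal.ofReal (2 / 3) * ENNReal.ofReal (normSqDist v w) := by
  have hm := measurable_normSqDist (n := n)
  have hc := measurable_columnStep (n := n)
  simp only [cKacStep_eq_columnStep]
  rw [lintegral_cKacSeedMeasure h (G := fun σ c =>
    ENNReal.ofReal (normSqDist (columnStep σ c v) (columnStep σ c w))) fun σ => by fun_prop]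
  simp only [lintegral_normSqDist_columnStep]
  rw [lintegral_uniformPM_ofReal h fun σ => by positivity, ← ENNReal.ofReal_mul (by norm_num)]
  refine ENNReal.ofReal_le_ofReal ?_
  have hc : (0 : ℝ) < Fintype.card (PerfectMatching n) := by exact_mod_cast Fintype.card_pos
  rw [div_le_iff₀ hc, ← Finset.mul_sum]
  have hsum := PerfectMatching.sum_sum_sq_add_le
    (d := fun i => Complex.normSq (v i) - Complex.normSq (w i))
    (by rw [Finset.sum_sub_distrib, hvw, sub_self])
  simp only [normSqDist]
  linarith

theorem sum_normSq_cKacStep {n : ℕ} (s : CKacSeed n) (v : Fin n → ℂ) :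
    ∑ i, Complex.normSq (cKacStep s v i) = ∑ i, Complex.normSq (v i) := by
  rw [cKacStep_eq_columnStep]
  refine s.1.sum_congr fun i hi => ?_
  rw [columnStep_of_le hi, columnStep_apply_of_le hi, normSq_mul_sqrt_pairNormSq,
    normSq_mul_sqrt_pairNormSq, ← add_mul]
  have h := pairNormSq_su2Column (s.2.1 i, s.2.2.1 i, s.2.2.2 i)
  rw [pairNormSq] at h
  rw [seedColumns, h, one_mul, pairNormSq]

/-- The coupling distance contracts by `2 / 3` in expectation at every step. -/
theorem lintegral_normSqDist_cKacWalk_le {n : ℕ} (h : Nonempty (PerfectMatching n)) (T : ℕ)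
    {v w : Fin n → ℂ} (hvw : ∑ i, Complex.normSq (v i) = ∑ i, Complex.normSq (w i)) :
    ∫⁻ s, ENNReal.ofReal (normSqDist (cKacWalk s v) (cKacWalk s w))
        ∂(Measure.pi fun _ : Fin T => cKacSeedMeasure n h) ≤
      ENNReal.ofReal (2 / 3) ^ T * ENNReal.ofReal (normSqDist v w) := by
  have hm := measurable_normSqDist (n := n)
  induction T generalizing v w with
  | zero => simp [cKacWalk_zero]
  | succ T ih =>
    have hw := measurable_cKacWalk (n := n) T
    have hs := measurable_cKacStep (n := n)
    simp only [cKacWalk_succ]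
    rw [lintegral_pi_succ (cKacSeedMeasure n h) (F := fun a t => ENNReal.ofReal
      (normSqDist (cKacWalk t (cKacStep a v)) (cKacWalk t (cKacStep a w)))) (by fun_prop)]
    calc _ ≤ ∫⁻ a, ENNReal.ofReal (2 / 3) ^ T *
          ENNReal.ofReal (normSqDist (cKacStep a v) (cKacStep a w)) ∂cKacSeedMeasure n h :=
        lintegral_mono fun a => ih (by rw [sum_normSq_cKacStep, sum_normSq_cKacStep, hvw])
      _ = ENNReal.ofReal (2 / 3) ^ T * ∫⁻ a, ENNReal.ofReal
          (normSqDist (cKacStep a v) (cKacStep a w)) ∂cKacSeedMeasure n h :=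
        lintegral_const_mul _ (by fun_prop)
      _ ≤ ENNReal.ofReal (2 / 3) ^ T *
          (ENNReal.ofReal (2 / 3) * ENNReal.ofReal (normSqDist v w)) := by
        gcongr
        exact lintegral_normSqDist_cKacStep_le h hvw
      _ = _ := by rw [pow_succ, mul_assoc]

/-- Multiples of a common phase by nonnegative reals. -/
theorem norm_mul_sub_mul_sq_le (a : ℂ) {x y : ℝ} (hx : 0 ≤ x) (hy : 0 ≤ y) :
    ‖a * x - a * y‖ ^ 2 ≤ |Complex.normSq (a * x) - Complex.normSq (a * y)| := by
  have h : (x - y) ^ 2 ≤ |x * x - y * y| := by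
    rw [← sq_abs, show x * x - y * y = (x + y) * (x - y) by ring, abs_mul,
      abs_of_nonneg (add_nonneg hx hy), sq]
    gcongr
    exact abs_le.2 ⟨by linarith, by linarith⟩
  rw [← mul_sub, ← Complex.ofReal_sub, ← Complex.normSq_eq_norm_sq]
  simp only [Complex.normSq_mul, Complex.normSq_ofReal]
  rw [← mul_sub, abs_mul, abs_of_nonneg (Complex.normSq_nonneg a), ← sq (x - y)]
  exact mul_le_mul_of_nonneg_left h (Complex.normSq_nonneg a)

theorem norm_cKacStep_sub_sq_le {n : ℕ} (s : CKacSeed n) (v w : Fin n → ℂ) (i : Fin n) :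
    ‖cKacStep s v i - cKacStep s w i‖ ^ 2 ≤
      |Complex.normSq (cKacStep s v i) - Complex.normSq (cKacStep s w i)| := by
  simp only [cKacStep_eq_columnStep, columnStep]
  split_ifs <;> exact norm_mul_sub_mul_sq_le _ (Real.sqrt_nonneg _) (Real.sqrt_nonneg _)

theorem norm_cKacWalk_sub_pow_four_le {n T : ℕ} (hT : T ≠ 0) (s : Fin T → CKacSeed n)
    (v w : Fin n → ℂ) :
    ‖WithLp.toLp 2 (cKacWalk s v) - WithLp.toLp 2 (cKacWalk s w)‖ ^ 4 ≤
      n * normSqDist (cKacWalk s v) (cKacWalk s w) := by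
  obtain ⟨T, rfl⟩ := Nat.exists_eq_succ_of_ne_zero hT
  simp only [Nat.succ_eq_add_one, cKacWalk_succ_last]
  set X := cKacStep (s (Fin.last T)) (cKacWalk (fun i => s i.castSucc) v)
  set Y := cKacStep (s (Fin.last T)) (cKacWalk (fun i => s i.castSucc) w)
  have h1 : ‖WithLp.toLp 2 X - WithLp.toLp 2 Y‖ ^ 2 ≤
      ∑ i, |Complex.normSq (X i) - Complex.normSq (Y i)| := by
    rw [EuclideanSpace.norm_sq_eq]
    exact Finset.sum_le_sum fun i _ => norm_cKacStep_sub_sq_le _ _ _ i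
  calc ‖WithLp.toLp 2 X - WithLp.toLp 2 Y‖ ^ 4 = (‖WithLp.toLp 2 X - WithLp.toLp 2 Y‖ ^ 2) ^ 2 := by
        ring
    _ ≤ (∑ i, |Complex.normSq (X i) - Complex.normSq (Y i)|) ^ 2 := by gcongr
    _ ≤ n * normSqDist X Y := by
        simpa [normSqDist] using sq_sum_le_card_mul_sum_sq (s := Finset.univ)
          (f := fun i => |Complex.normSq (X i) - Complex.normSq (Y i)|)

theorem normSqDist_le_two {n : ℕ} {v w : Fin n → ℂ} (hv : ∑ i, Complex.normSq (v i) = 1)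
    (hw : ∑ i, Complex.normSq (w i) = 1) : normSqDist v w ≤ 2 := by
  have h : ∀ u : Fin n → ℂ, ∑ i, Complex.normSq (u i) = 1 → ∀ i, Complex.normSq (u i) ≤ 1 :=
    fun u hu i => hu ▸ Finset.single_le_sum (f := fun i => Complex.normSq (u i))
      (fun j _ => Complex.normSq_nonneg _) (Finset.mem_univ i)
  calc normSqDist v w ≤ ∑ i, (Complex.normSq (v i) + Complex.normSq (w i)) :=
        Finset.sum_le_sum fun i _ => by
          nlinarith [h v hv i, h w hw i, Complex.normSq_nonneg (v i), Complex.normSq_nonneg (w i)]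
    _ = 2 := by rw [Finset.sum_add_distrib, hv, hw]; norm_num

theorem le_pow_four_div_add {x t : ℝ} (ht : 0 < t) : x ≤ x ^ 4 / (4 * t ^ 3) + 3 / 4 * t := by
  have h : x ^ 4 / (4 * t ^ 3) + 3 / 4 * t - x =
      (x - t) ^ 2 * ((x + t) ^ 2 + 2 * t ^ 2) / (4 * t ^ 3) := by
    field_simp; ring
  have : 0 ≤ x ^ 4 / (4 * t ^ 3) + 3 / 4 * t - x := h ▸ by positivity
  linarith

theorem lintegral_dist_cKacWalk_le {n : ℕ} (h : Nonempty (PerfectMatching n)) {T : ℕ} (hT : T ≠ 0)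
    {v w : Fin n → ℂ} (hv : ∑ i, Complex.normSq (v i) = 1)
    (hw : ∑ i, Complex.normSq (w i) = 1) {t : ℝ} (ht : 0 < t)
    (hnT : 2 * n * (2 / 3) ^ T ≤ t ^ 4) :
    ∫⁻ s, ENNReal.ofReal ‖WithLp.toLp 2 (cKacWalk s v) - WithLp.toLp 2 (cKacWalk s w)‖
      ∂(Measure.pi fun _ : Fin T => cKacSeedMeasure n h) ≤ ENNReal.ofReal t := by
  have hm := measurable_normSqDist (n := n)
  have hwm := measurable_cKacWalk (n := n) T
  calc _ ≤ ∫⁻ s, (ENNReal.ofReal (n / (4 * t ^ 3)) *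
          ENNReal.ofReal (normSqDist (cKacWalk s v) (cKacWalk s w)) + ENNReal.ofReal (3 / 4 * t))
          ∂(Measure.pi fun _ : Fin T => cKacSeedMeasure n h) := by
        refine lintegral_mono fun s => ?_
        rw [← ENNReal.ofReal_mul (by positivity), ← ENNReal.ofReal_add
          (mul_nonneg (by positivity) (normSqDist_nonneg _ _)) (by positivity)]
        refine ENNReal.ofReal_le_ofReal ((le_pow_four_div_add ht).trans ?_)
        rw [div_mul_eq_mul_div (n : ℝ)]
        gcongr
        exact norm_cKacWalk_sub_pow_four_le hT s v w
    _ = ENNReal.ofReal (n / (4 * t ^ 3)) * ∫⁻ s,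
          ENNReal.ofReal (normSqDist (cKacWalk s v) (cKacWalk s w))
          ∂(Measure.pi fun _ : Fin T => cKacSeedMeasure n h) + ENNReal.ofReal (3 / 4 * t) := by
        rw [lintegral_add_right _ measurable_const, lintegral_const_mul _ (by fun_prop)]
        simp
    _ ≤ ENNReal.ofReal (n / (4 * t ^ 3)) * (ENNReal.ofReal (2 / 3) ^ T * ENNReal.ofReal 2) +
          ENNReal.ofReal (3 / 4 * t) := by
        gcongr
        refine (lintegral_normSqDist_cKacWalk_le h T (hv.trans hw.symm)).trans ?_
        gcongr
        exact normSqDist_le_two hv hw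
    _ ≤ ENNReal.ofReal t := by
        rw [← ENNReal.ofReal_pow (by norm_num), ← ENNReal.ofReal_mul (by positivity),
          ← ENNReal.ofReal_mul (by positivity), ← ENNReal.ofReal_add (by positivity)
          (by positivity)]
        refine ENNReal.ofReal_le_ofReal ?_
        have h1 : n / (4 * t ^ 3) * ((2 / 3) ^ T * 2) ≤ t / 4 := by
          rw [div_mul_eq_mul_div, div_le_iff₀ (by positivity)]
          linarith [show t / 4 * (4 * t ^ 3) = t ^ 4 by ring]
        linarith

theorem two_mul_mul_pow_ceil_le {c : ℝ} (hc : 0 < c) {n : ℕ} (hn : 2 ≤ n) :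
    2 * n * (2 / 3 : ℝ) ^ ⌈10 * (c + 1) * Real.logb 2 n⌉₊ ≤ ((n : ℝ) ^ (-c)) ^ 4 := by
  have hn' : (2 : ℝ) ≤ n := by exact_mod_cast hn
  have hn0 : (0 : ℝ) < n := by linarith
  have hexp : (2 / 3 : ℝ) ≤ 2 ^ (-(1 / 2) : ℝ) := by
    rw [Real.rpow_neg (by norm_num), ← Real.sqrt_eq_rpow]
    rw [le_inv_comm₀ (by norm_num) (by positivity)]
    exact Real.sqrt_le_iff.2 ⟨by norm_num, by norm_num⟩
  have hpow : (2 / 3 : ℝ) ^ ⌈10 * (c + 1) * Real.logb 2 n⌉₊ ≤ (n : ℝ) ^ (-5 * (c + 1)) := by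
    calc (2 / 3 : ℝ) ^ ⌈10 * (c + 1) * Real.logb 2 n⌉₊
        ≤ ((2 : ℝ) ^ (-(1 / 2) : ℝ)) ^ ⌈10 * (c + 1) * Real.logb 2 n⌉₊ := by gcongr
      _ = (2 : ℝ) ^ (-(1 / 2) * (⌈10 * (c + 1) * Real.logb 2 n⌉₊ : ℝ)) := by
          rw [Real.rpow_mul_natCast (by norm_num)]
      _ ≤ (2 : ℝ) ^ (Real.logb 2 n * (-5 * (c + 1))) := by
          refine Real.rpow_le_rpow_of_exponent_le (by norm_num) ?_
          linarith [Nat.le_ceil (10 * (c + 1) * Real.logb 2 n)]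
      _ = (n : ℝ) ^ (-5 * (c + 1)) := by
          rw [Real.rpow_mul (by norm_num), Real.rpow_logb (by norm_num) (by norm_num) hn0]
  calc 2 * n * (2 / 3 : ℝ) ^ ⌈10 * (c + 1) * Real.logb 2 n⌉₊
      ≤ n * n * (n : ℝ) ^ (-5 * (c + 1)) := by gcongr
    _ = (n : ℝ) ^ (2 + -5 * (c + 1)) := by
        rw [Real.rpow_add hn0, Real.rpow_two, sq]
    _ ≤ (n : ℝ) ^ (-c * (4 : ℕ)) := by
        refine Real.rpow_le_rpow_of_exponent_le (by linarith) ?_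
        push_cast
        linarith
    _ = ((n : ℝ) ^ (-c)) ^ 4 := Real.rpow_mul_natCast hn0.le _ _

theorem W1_le_integral {E : Type*} [MeasurableSpace E] [NormedAddCommGroup E] {μ ν : Measure E}
    {γ : Measure (E × E)} (h₁ : γ.map Prod.fst = μ) (h₂ : γ.map Prod.snd = ν) :
    W1 μ ν ≤ ∫ p, ‖p.1 - p.2‖ ∂γ := by
  refine ciInf_le (f := fun γ : {γ : Measure (E × E) // γ.map Prod.fst = μ ∧ γ.map Prod.snd = ν} =>
    ∫ p, ‖p.1 - p.2‖ ∂γ.1) ⟨0, ?_⟩ ⟨γ, h₁, h₂⟩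
  rintro _ ⟨γ, rfl⟩
  exact integral_nonneg fun _ => norm_nonneg _

/-- The synchronous coupling of the walks started from `x0` and from a `μ`-random point. -/
noncomputable def cKacCoupling {n : ℕ} (h : Nonempty (PerfectMatching n)) (T : ℕ)
    (x0 : Fin n → ℂ) (μ : Measure (EuclideanSpace ℂ (Fin n))) :
    Measure (EuclideanSpace ℂ (Fin n) × EuclideanSpace ℂ (Fin n)) :=
  ((Measure.pi fun _ : Fin T => cKacSeedMeasure n h).prod μ).map fun p =>
    (WithLp.toLp 2 (cKacWalk p.1 x0), WithLp.toLp 2 (cKacWalk p.1 p.2.ofLp))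

theorem lintegral_cKacCoupling {n : ℕ} (h : Nonempty (PerfectMatching n)) (T : ℕ)
    (x0 : Fin n → ℂ) (μ : Measure (EuclideanSpace ℂ (Fin n))) [IsProbabilityMeasure μ]
    {f : EuclideanSpace ℂ (Fin n) × EuclideanSpace ℂ (Fin n) → ℝ≥0∞} (hf : Measurable f) :
    ∫⁻ p, f p ∂cKacCoupling h T x0 μ = ∫⁻ y, ∫⁻ s,
      f (WithLp.toLp 2 (cKacWalk s x0), WithLp.toLp 2 (cKacWalk s y.ofLp))
      ∂(Measure.pi fun _ : Fin T => cKacSeedMeasure n h) ∂μ := by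
  have hwm := measurable_cKacWalk (n := n) T
  rw [cKacCoupling, lintegral_map hf (by fun_prop), lintegral_prod_symm _ (by fun_prop)]

theorem map_fst_cKacCoupling {n : ℕ} (h : Nonempty (PerfectMatching n)) (T : ℕ)
    (x0 : Fin n → ℂ) (μ : Measure (EuclideanSpace ℂ (Fin n))) [IsProbabilityMeasure μ] :
    (cKacCoupling h T x0 μ).map Prod.fst = cKacLaw n T h x0 := by
  have hwm := measurable_cKacWalk (n := n) T
  refine Measure.ext_of_lintegral _ fun f hf => ?_
  rw [lintegral_map hf measurable_fst, lintegral_cKacCoupling h T x0 μ (by fun_prop), cKacLaw]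
  simp only [WithLp.equiv_symm_apply]
  rw [lintegral_map hf (by fun_prop)]
  simp

theorem map_snd_cKacCoupling {n : ℕ} (h : Nonempty (PerfectMatching n)) (T : ℕ)
    (x0 : Fin n → ℂ) {μ : Measure (EuclideanSpace ℂ (Fin n))} [IsProbabilityMeasure μ]
    (hμ : ∀ U : EuclideanSpace ℂ (Fin n) ≃ₗᵢ[ℂ] EuclideanSpace ℂ (Fin n), μ.map U = μ) :
    (cKacCoupling h T x0 μ).map Prod.snd = μ := by
  refine Measure.ext_of_lintegral _ fun f hf => ?_
  rw [lintegral_map hf measurable_snd, lintegral_cKacCoupling h T x0 μ (by fun_prop)]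
  exact lintegral_cKacWalk h T hμ hf

theorem W1_cKacLaw_le {n : ℕ} (h : Nonempty (PerfectMatching n)) {T : ℕ} (hT : T ≠ 0)
    {x0 : Fin n → ℂ} (hx0 : ∑ i, Complex.normSq (x0 i) = 1)
    {μ : Measure (EuclideanSpace ℂ (Fin n))} [IsProbabilityMeasure μ]
    (hsphere : μ (Metric.sphere (0 : EuclideanSpace ℂ (Fin n)) 1) = 1)
    (hμ : ∀ U : EuclideanSpace ℂ (Fin n) ≃ₗᵢ[ℂ] EuclideanSpace ℂ (Fin n), μ.map U = μ)
    {t : ℝ} (ht : 0 < t) (hnT : 2 * n * (2 / 3) ^ T ≤ t ^ 4) : W1 (cKacLaw n T h x0) μ ≤ t := by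
  refine (W1_le_integral (map_fst_cKacCoupling h T x0 μ)
    (map_snd_cKacCoupling h T x0 hμ)).trans ?_
  rw [integral_eq_lintegral_of_nonneg_ae (Filter.Eventually.of_forall fun _ => norm_nonneg _)
    (by fun_prop)]
  refine ENNReal.toReal_le_of_le_ofReal ht.le ?_
  rw [lintegral_cKacCoupling h T x0 μ (by fun_prop)]
  have hae : ∀ᵐ y ∂μ, y ∈ Metric.sphere (0 : EuclideanSpace ℂ (Fin n)) 1 :=
    (prob_compl_eq_zero_iff Metric.isClosed_sphere.measurableSet).2 hsphere
  calc _ ≤ ∫⁻ _, ENNReal.ofReal t ∂μ := by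
        refine lintegral_mono_ae (hae.mono fun y hy => ?_)
        refine lintegral_dist_cKacWalk_le h hT hx0 ?_ ht hnT
        have hy1 : ‖y‖ ^ 2 = 1 := by rw [mem_sphere_zero_iff_norm.1 hy, one_pow]
        rw [EuclideanSpace.norm_sq_eq] at hy1
        simpa only [Complex.normSq_eq_norm_sq] using hy1
    _ = ENNReal.ofReal t := by simp

/-- For every `c > 0` and sufficiently large (even) `n`, after
`T = 10(c+1) log₂ n` steps the complex parallel Kac's walk on the complex unit sphere satisfies
`W₁(L(X_T), μ) ≤ 2^{-c log₂ n} = n^{-c}` from any starting point, where `μ` is the Haar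
(unitarily invariant) probability measure on the complex unit sphere. -/
theorem cKacWalk_W1_mixing :
    ∀ c : ℝ, 0 < c → ∃ N : ℕ, ∀ n : ℕ, N ≤ n → ∀ m : ℕ, n = 2 * m →
    ∀ h : Nonempty (PerfectMatching n),
    ∀ _ : MeasurableSpace (EuclideanSpace ℂ (Fin n)),
    ∀ _ : BorelSpace (EuclideanSpace ℂ (Fin n)),
    ∀ x0 : Fin n → ℂ, (∑ i, Complex.normSq (x0 i) = 1) →
    ∀ μ : Measure (EuclideanSpace ℂ (Fin n)), IsProbabilityMeasure μ →
      μ (Metric.sphere (0 : EuclideanSpace ℂ (Fin n)) 1) = 1 →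
      (∀ U : EuclideanSpace ℂ (Fin n) ≃ₗᵢ[ℂ] EuclideanSpace ℂ (Fin n), μ.map U = μ) →
      W1 (cKacLaw n (⌈10 * (c + 1) * Real.logb 2 n⌉₊) h x0) μ ≤ (n : ℝ) ^ (-c) := by
  intro c hc
  refine ⟨2, fun n hn m _ h inst hB x0 hx0 μ hprob hsphere hμ => ?_⟩
  obtain rfl : inst = WithLp.measurableSpace 2 (Fin n → ℂ) :=
    hB.measurable_eq.trans (PiLp.borelSpace 2 (X := fun _ : Fin n => ℂ)).measurable_eq.symm
  have hn' : (2 : ℝ) ≤ n := by exact_mod_cast hn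
  refine W1_cKacLaw_le h ?_ hx0 hsphere hμ (Real.rpow_pos_of_pos (by linarith) _)
    (two_mul_mul_pow_ceil_le hc hn)
  have hlog : 0 < Real.logb 2 n := Real.logb_pos (by norm_num) (by linarith)
  exact (Nat.ceil_pos.2 (by positivity)).ne'
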